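/- Let L be a complete lattice with J ⊆ L completely join-generating and M ⊆ L completely meet-generating, let ◇ : L → L be completely join-preserving and □ : L → L completely meet-preserving with left adjoint ◆. Then (∀ a ∈ L, ◇ (□ a) ≤ □ (◇ a)) if and only if (∀ j ∈ J, ∀ m ∈ M, ◇ (◆ j) ≤ m → ◆ (◇ j) ≤ m). -/

import Mathlib

theorem alba_correspondence_axiom_C
    {L : Type*} [CompleteLattice L] (J M : Set L)
    (hJ : ∀ u : L, u = sSup {j ∈ J | j ≤ u})
    (hM : ∀ u : L, u = sInf {m ∈ M | u ≤ m})
    (d b bd : L → L)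
    (hd : ∀ S : Set L, d (sSup S) = sSup (d '' S))
    (hb : ∀ S : Set L, b (sInf S) = sInf (b '' S))
    (hadj : ∀ u v : L, bd u ≤ v ↔ u ≤ b v) :
    (∀ a : L, d (b a) ≤ b (d a)) ↔
      (∀ j ∈ J, ∀ m ∈ M, d (bd j) ≤ m → bd (d j) ≤ m) := by
  have mono : ∀ x y : L, x ≤ y → d x ≤ d y := by
    intro x y h
    have h1 := hd {x, y}
    rw [sSup_pair, sup_eq_right.mpr h] at h1
    rw [h1]
    exact le_sSup ⟨x, by simp, rfl⟩
  constructor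
  · intro h j _ m _ hm
    refine le_trans ?_ hm
    rw [hadj]
    exact (mono _ _ ((hadj j (bd j)).1 le_rfl)).trans (h (bd j))
  · intro h a
    rw [hJ (b a), hd]
    apply sSup_le
    rintro _ ⟨j, ⟨hj, hja⟩, rfl⟩
    rw [← hadj, hM (d a)]
    apply le_sInf
    rintro m ⟨hm, ham⟩
    exact h j hj m hm ((mono _ _ ((hadj j a).2 hja)).trans ham)
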